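/- arXiv:1805.04065 — 2 statements merged into one kernel-verified Lean document; each statement's English description precedes it below -/
import Mathlib

section
/- For λ ⊢ n, σ ∈ S_r with r ≤ n, and the total sum TS^λ(σ) := (1/dim λ)·Σ_{T,T'∈SYT(λ)} π^λ(σ)_{T,T'} of entries of Young's orthogonal representation matrix, one has TS^λ(σ) = Σ_{τ∈S_r} E_Pl^r[χ̂^ν(τ)·TS^ν(σ)]·χ̂^λ(τ), where E_Pl^r denotes expectation over ν ⊢ r under the Plancherel measure (dim ν)²/r! and χ̂ denotes normalized character χ/dim. -/
open scoped Classical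

noncomputable section

/-- A standard Young tableau of shape `μ ⊢ n`: a listing of the cells of `μ`
(`pos i` is the cell containing the entry `i+1`) increasing along rows and columns. -/
structure SYT (μ : YoungDiagram) where
  pos : Fin μ.card → ℕ × ℕ
  inj : Function.Injective pos
  range_eq : ∀ c : ℕ × ℕ, (∃ i, pos i = c) ↔ c ∈ μ
  row_lt : ∀ a b, (pos a).1 = (pos b).1 → (pos a).2 < (pos b).2 → a < b
  col_lt : ∀ a b, (pos a).2 = (pos b).2 → (pos a).1 < (pos b).1 → a < b

/-- The content of a box `(i, j)` (row `i`, column `j`) is `j − i`. -/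
def content (c : ℕ × ℕ) : ℝ := (c.2 : ℝ) - (c.1 : ℝ)

/-- `ρ` is Young's orthogonal representation of `S_{|μ|}` for the shape `μ`, given entrywise
on the basis of standard Young tableaux: it is multiplicative, sends `1` to the identity
matrix, and on an adjacent transposition `(k, k+1)` (labels `a+1, b+1` with `b = a+1`) the
`(T, S)` entry is `1/d_k(T)` if `S = T`, `√(1 − 1/d_k(T)²)` if `S = (k, k+1)T`, and `0`
otherwise, where `d_k(T)` is the signed content distance between `k` and `k+1` in `T`. -/
def IsYoungOrthogonal (μ : YoungDiagram)
    (ρ : Equiv.Perm (Fin μ.card) → SYT μ → SYT μ → ℝ) : Prop :=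
  (∀ T S : SYT μ, ρ 1 T S = if T = S then 1 else 0) ∧
  (∀ σ τ : Equiv.Perm (Fin μ.card), ∀ T S : SYT μ,
    ρ (σ * τ) T S = ∑ᶠ U : SYT μ, ρ σ T U * ρ τ U S) ∧
  (∀ a b : Fin μ.card, (b : ℕ) = (a : ℕ) + 1 → ∀ T S : SYT μ,
    ρ (Equiv.swap a b) T S =
      if S = T then 1 / (content (T.pos a) - content (T.pos b))
      else if S.pos = T.pos ∘ (Equiv.swap a b) then
        Real.sqrt (1 - 1 / (content (T.pos a) - content (T.pos b)) ^ 2)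
      else 0)

/-- The normalized total sum `TS^μ(σ)` of the entries of the representation matrix. -/
def totalSum (μ : YoungDiagram) (ρ : Equiv.Perm (Fin μ.card) → SYT μ → SYT μ → ℝ)
    (σ : Equiv.Perm (Fin μ.card)) : ℝ :=
  (∑ᶠ T : SYT μ, ∑ᶠ S : SYT μ, ρ σ T S) / (Nat.card (SYT μ) : ℝ)

/-- The normalized character `χ̂^μ(σ) = (tr π^μ(σ)) / dim μ`. -/
def normTrace (μ : YoungDiagram) (ρ : Equiv.Perm (Fin μ.card) → SYT μ → SYT μ → ℝ)
    (σ : Equiv.Perm (Fin μ.card)) : ℝ :=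
  (∑ᶠ T : SYT μ, ρ σ T T) / (Nat.card (SYT μ) : ℝ)

theorem perm_adj_ind {r : ℕ} (P : Equiv.Perm (Fin r) → Prop) (h1 : P 1)
    (hm : ∀ σ τ, P σ → P τ → P (σ * τ))
    (hs : ∀ a b : Fin r, (b : ℕ) = (a : ℕ) + 1 → P (Equiv.swap a b)) (σ) : P σ := by
  cases r with
  | zero => rw [Subsingleton.elim σ 1]; exact h1
  | succ n =>
    have hσ : σ ∈ Submonoid.closure (Set.range fun i : Fin n ↦ Equiv.swap i.castSucc i.succ) := by
      rw [Equiv.Perm.mclosure_swap_castSucc_succ]; trivial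
    induction hσ using Submonoid.closure_induction with
    | mem x hx => obtain ⟨i, rfl⟩ := hx; exact hs _ _ (by simp)
    | one => exact h1
    | mul x y _ _ hx hy => exact hm _ _ hx hy

structure YR {r : ℕ} {X : Type} [Fintype X] (p : X → Fin r → ℕ × ℕ)
    (R : Equiv.Perm (Fin r) → Matrix X X ℝ) : Prop where
  one : R 1 = 1
  mul : ∀ σ τ, R (σ * τ) = R σ * R τ
  pinj : ∀ T, Function.Injective (p T)
  ext : ∀ T S, p T = p S → T = S
  low : ∀ T i c, c ≤ p T i → ∃ j, j ≤ i ∧ p T j = c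
  swap : ∀ a b : Fin r, (b : ℕ) = (a : ℕ) + 1 → ∀ T S, R (Equiv.swap a b) T S =
      if S = T then 1 / (content (p T a) - content (p T b))
      else if p S = p T ∘ (Equiv.swap a b) then
        Real.sqrt (1 - 1 / (content (p T a) - content (p T b)) ^ 2)
      else 0
  adm : ∀ T (a b : Fin r), (b : ℕ) = (a : ℕ) + 1 → ¬ p T a ≤ p T b →
    ∃ S, p S = p T ∘ Equiv.swap a b
  same : ∀ T T0 i, ∃ j, p T0 j = p T i

section
variable {r : ℕ} {X Y : Type} [Fintype X] [Fintype Y] {p : X → Fin r → ℕ × ℕ}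
    {R : Equiv.Perm (Fin r) → Matrix X X ℝ} {q : Y → Fin r → ℕ × ℕ}
    {Q : Equiv.Perm (Fin r) → Matrix Y Y ℝ}

theorem content_eq_iff (c d : ℕ × ℕ) : content c = content d ↔ c.2 + d.1 = d.2 + c.1 := by
  unfold content
  rw [sub_eq_sub_iff_add_eq_add]
  exact_mod_cast Iff.rfl

theorem YR.not_le (h : YR p R) (T : X) (a b : Fin r) (hab : a < b) : ¬ p T b ≤ p T a := by
  intro hle
  obtain ⟨j, hj, e⟩ := h.low T a _ hle
  have := h.pinj T e
  subst this
  exact absurd hab (not_lt.2 hj)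

theorem YR.content_ne (h : YR p R) (T : X) (a b : Fin r) (hab : (b : ℕ) = (a : ℕ) + 1) :
    content (p T a) - content (p T b) ≠ 0 := by
  rw [sub_ne_zero, Ne, content_eq_iff]
  intro e
  have hlt : a < b := by rw [Fin.lt_def]; omega
  have h1 := h.not_le T a b hlt
  rw [Prod.le_def] at h1
  have h2 : (p T a).1 < (p T b).1 := by
    by_contra hc
    apply h1
    constructor <;> omega
  obtain ⟨k, hk, ek⟩ := h.low T b ((p T a).1, (p T a).2 + 1)
    (by rw [Prod.le_def]; constructor <;> simp <;> omega)
  have hak : ¬ k < a := fun hka => h.not_le T k a hka (by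
    rw [ek, Prod.le_def]; simp)
  have : k = a ∨ k = b := by
    rw [Fin.lt_def] at hak
    rw [Fin.le_def] at hk
    rw [Fin.ext_iff, Fin.ext_iff]; omega
  rcases this with rfl | rfl
  · have := congrArg Prod.snd ek; simp at this
  · have := congrArg Prod.fst ek; simp at this; omega

theorem YR.sqrt_ne (h : YR p R) (T : X) (a b : Fin r) (hab : (b : ℕ) = (a : ℕ) + 1)
    (hn : ¬ p T a ≤ p T b) :
    Real.sqrt (1 - 1 / (content (p T a) - content (p T b)) ^ 2) ≠ 0 := by
  have hlt : a < b := by rw [Fin.lt_def]; omega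
  have h1 := h.not_le T a b hlt
  rw [Prod.le_def] at h1 hn
  apply ne_of_gt
  rw [Real.sqrt_pos]
  have h4 : 1 < (content (p T a) - content (p T b)) ^ 2 := by
    rw [one_lt_sq_iff_one_lt_abs]
    unfold content
    rcases lt_or_ge (p T a).1 (p T b).1 with hc | hc
    · have hd : (p T b).2 < (p T a).2 := by
        by_contra hd; apply hn; constructor <;> omega
      have e1 : ((p T a).1 : ℝ) + 1 ≤ (p T b).1 := by exact_mod_cast hc
      have e2 : ((p T b).2 : ℝ) + 1 ≤ (p T a).2 := by exact_mod_cast hd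
      rw [lt_abs]; left; linarith
    · have hd : (p T a).2 < (p T b).2 := by
        by_contra hd; apply h1; constructor <;> omega
      have hc' : (p T b).1 < (p T a).1 := by
        by_contra hd; apply hn; constructor <;> omega
      have e1 : ((p T b).1 : ℝ) + 1 ≤ (p T a).1 := by exact_mod_cast hc'
      have e2 : ((p T a).2 : ℝ) + 1 ≤ (p T b).2 := by exact_mod_cast hd
      rw [lt_abs]; right; linarith
  have : 1 / (content (p T a) - content (p T b)) ^ 2 < 1 := by
    rw [div_lt_one (by linarith)]; exact h4
  linarith

theorem YR.zero (h : YR p R) (T : X) (k : Fin r) (hk : (k : ℕ) = 0) : p T k = (0, 0) := by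
  obtain ⟨j, hj, e⟩ := h.low T k (0, 0) (by rw [Prod.le_def]; simp)
  have : j = k := by rw [Fin.le_def] at hj; rw [Fin.ext_iff]; omega
  rw [← this, e]

theorem YR.recur (h : YR p R) (a b : Fin r) (hab : (b : ℕ) = (a : ℕ) + 1) :
    Matrix.diagonal (fun T => content (p T b)) =
      R (Equiv.swap a b) * Matrix.diagonal (fun T => content (p T a)) * R (Equiv.swap a b)
        - R (Equiv.swap a b) := by
  have h1 : R (Equiv.swap a b) * R (Equiv.swap a b) = 1 := by
    rw [← h.mul, Equiv.swap_mul_self, h.one]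
  have h2 : R (Equiv.swap a b) * Matrix.diagonal (fun T => content (p T a)) -
      Matrix.diagonal (fun T => content (p T b)) * R (Equiv.swap a b) = 1 := by
    ext T S
    rw [Matrix.sub_apply, Matrix.mul_diagonal, Matrix.diagonal_mul, h.swap a b hab,
      Matrix.one_apply]
    by_cases hTS : S = T
    · subst hTS
      have := h.content_ne S a b hab
      simp only [if_true]
      field_simp
    · rw [if_neg hTS, if_neg (show ¬ T = S from fun e => hTS e.symm)]
      by_cases hp : p S = p T ∘ Equiv.swap a b
      · rw [if_pos hp, hp]; simp; ring
      · rw [if_neg hp]; ring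
  rw [sub_eq_iff_eq_add] at h2
  rw [h2, add_mul, mul_assoc, h1]
  simp

theorem YR.support (h : YR p R) (h' : YR q Q) (M : Matrix X Y ℝ)
    (hM : ∀ σ, R σ * M = M * Q σ) (T : X) (T' : Y) (hne : M T T' ≠ 0) : p T = q T' := by
  have key : ∀ (k : ℕ) (i : Fin r), (i : ℕ) = k →
      Matrix.diagonal (fun T => content (p T i)) * M =
        M * Matrix.diagonal (fun T => content (q T i)) := by
    intro k
    induction k with
    | zero =>
      intro i hi
      ext T T'
      rw [Matrix.mul_diagonal, Matrix.diagonal_mul, h.zero T i hi, h'.zero T' i hi, mul_comm]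
    | succ k ih =>
      intro i hi
      have hlt : k < r := by omega
      have ih := ih ⟨k, hlt⟩ rfl
      have hs := hM (Equiv.swap ⟨k, hlt⟩ i)
      rw [h.recur ⟨k, hlt⟩ i (by simpa using hi), h'.recur ⟨k, hlt⟩ i (by simpa using hi)]
      rw [Matrix.sub_mul, Matrix.mul_sub, hs, Matrix.mul_assoc, hs, Matrix.mul_assoc,
        ← Matrix.mul_assoc _ M, ih, ← Matrix.mul_assoc, ← Matrix.mul_assoc, hs]
      simp only [Matrix.mul_assoc]
  have hc : ∀ i, content (p T i) = content (q T' i) := by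
    intro i
    have := congrFun (congrFun (key i i rfl) T) T'
    rw [Matrix.mul_diagonal, Matrix.diagonal_mul, mul_comm] at this
    exact mul_left_cancel₀ hne this
  have fin : ∀ (k : ℕ) (i : Fin r), (i : ℕ) = k → p T i = q T' i := by
    intro k
    induction k using Nat.strong_induction_on with
    | _ k ih =>
      intro i hi
      have e := (content_eq_iff _ _).1 (hc i)
      rcases le_total (p T i).1 (q T' i).1 with hl | hl
      · obtain ⟨j, hj, ej⟩ := h'.low T' i (p T i) (by rw [Prod.le_def]; constructor <;> omega)
        rcases lt_or_eq_of_le hj with hj | rfl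
        · rw [← ih j (by rw [Fin.lt_def] at hj; omega) j rfl] at ej
          exact absurd (h.pinj T ej) (ne_of_lt hj)
        · exact ej.symm
      · obtain ⟨j, hj, ej⟩ := h.low T i (q T' i) (by rw [Prod.le_def]; constructor <;> omega)
        rcases lt_or_eq_of_le hj with hj | rfl
        · rw [ih j (by rw [Fin.lt_def] at hj; omega) j rfl] at ej
          exact absurd (h'.pinj T' ej) (ne_of_lt hj)
        · exact ej
  funext i
  exact fin i i rfl

theorem YR.step (h : YR p R) (M : Matrix X X ℝ) (hM : ∀ σ, R σ * M = M * R σ) (T S : X)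
    (a b : Fin r) (hab : (b : ℕ) = (a : ℕ) + 1) (hn : ¬ p T a ≤ p T b)
    (hS : p S = p T ∘ Equiv.swap a b) : M T T = M S S := by
  have hd : ∀ T S, T ≠ S → M T S = 0 := by
    intro T S hTS
    by_contra hne
    exact hTS (h.ext _ _ (h.support h M hM T S hne))
  have hST : S ≠ T := by
    rintro rfl
    have := congrFun hS a
    simp at this
    have := h.pinj S this
    rw [Fin.ext_iff] at this; omega
  have e := congrFun (congrFun (hM (Equiv.swap a b)) T) S
  rw [Matrix.mul_apply, Matrix.mul_apply, Finset.sum_eq_single S, Finset.sum_eq_single T,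
    h.swap a b hab, if_neg hST, if_pos hS, mul_comm] at e
  · exact (mul_right_cancel₀ (h.sqrt_ne T a b hab hn) e).symm
  · intro U _ hU; rw [hd T U hU.symm, zero_mul]
  · simp
  · intro U _ hU; rw [hd U S hU, mul_zero]
  · simp

theorem YR.const (h : YR p R) (M : Matrix X X ℝ) (hM : ∀ σ, R σ * M = M * R σ) (T T0 : X) :
    M T T = M T0 T0 := by
  by_contra hbad
  choose π hπ using fun T i => h.same T T0 i
  have hπi : ∀ T, Function.Injective (π T) := fun T i j e => by
    apply h.pinj T; rw [← hπ T i, ← hπ T j, e]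
  obtain ⟨T, hT, hmax⟩ := Finset.exists_max_image
    (Finset.univ.filter fun T => M T T ≠ M T0 T0)
    (fun T => ∑ i : Fin r, ((i : ℕ) : ℤ) * ((π T i : ℕ) : ℤ)) ⟨T, by simpa using hbad⟩
  simp only [Finset.mem_filter, Finset.mem_univ, true_and] at hT hmax
  by_cases hdesc : ∃ a b : Fin r, (b : ℕ) = (a : ℕ) + 1 ∧ π T b < π T a
  · obtain ⟨a, b, hab, hlt⟩ := hdesc
    have hn : ¬ p T a ≤ p T b := by
      intro hle
      rw [← hπ T b] at hle
      obtain ⟨k, hk, ek⟩ := h.low T0 _ _ hle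
      rw [← hπ T a] at ek
      rw [h.pinj T0 ek] at hk
      exact absurd hlt (not_lt.2 hk)
    obtain ⟨S, hS⟩ := h.adm T a b hab hn
    have hstep := h.step M hM T S a b hab hn hS
    have hle := hmax S (hstep ▸ hT)
    have hπS : ∀ i, π S i = π T (Equiv.swap a b i) := by
      intro i
      apply h.pinj T0
      rw [hπ, hπ, hS]; rfl
    have hne : a ≠ b := by rw [Ne, Fin.ext_iff]; omega
    have hsum : ∀ f : Fin r → ℤ, ∑ i, f i =
        f a + f b + ∑ i ∈ (Finset.univ.erase a).erase b, f i := by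
      intro f
      rw [← Finset.add_sum_erase _ f (Finset.mem_univ a),
        ← Finset.add_sum_erase _ f (show b ∈ Finset.univ.erase a by simp [hne.symm]), add_assoc]
    rw [hsum, hsum] at hle
    have hrest : ∑ i ∈ (Finset.univ.erase a).erase b, ((i : ℕ) : ℤ) * ((π S i : ℕ) : ℤ) =
        ∑ i ∈ (Finset.univ.erase a).erase b, ((i : ℕ) : ℤ) * ((π T i : ℕ) : ℤ) := by
      apply Finset.sum_congr rfl
      intro i hi
      simp at hi
      rw [hπS, Equiv.swap_apply_of_ne_of_ne hi.2 hi.1]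
    rw [hrest, hπS, hπS, Equiv.swap_apply_left, Equiv.swap_apply_right, hab] at hle
    rw [Fin.lt_def] at hlt
    push_cast at hle
    have : ((π T b : ℕ) : ℤ) < (π T a : ℕ) := by exact_mod_cast hlt
    nlinarith
  · push Not at hdesc
    have hmono : StrictMono (π T) := by
      cases r with
      | zero => intro i; exact i.elim0
      | succ n =>
        rw [Fin.strictMono_iff_lt_succ]
        intro i
        refine lt_of_le_of_ne (hdesc _ _ (by simp)) (fun e => ?_)
        have := hπi T e
        rw [Fin.ext_iff] at this; simp at this
    have hid : π T = id := by
      apply (StrictMono.range_inj hmono strictMono_id).1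
      rw [(Finite.injective_iff_surjective.1 (hπi T)).range_eq]; simp
    apply hT
    have : T0 = T := by
      apply h.ext
      funext i
      have := hπ T i
      rw [hid] at this
      exact this
    rw [this]

theorem YR.inv (h : YR p R) (σ) : R σ⁻¹ = (R σ).transpose := by
  induction σ using perm_adj_ind with
  | h1 => simp [h.one]
  | hm σ τ h1 h2 => rw [mul_inv_rev, h.mul, h.mul, h1, h2, Matrix.transpose_mul]
  | hs a b hab =>
    rw [Equiv.swap_inv]
    ext T S
    rw [Matrix.transpose_apply, h.swap a b hab, h.swap a b hab]
    by_cases hTS : S = T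
    · subst hTS; rfl
    · rw [if_neg hTS, if_neg (show ¬ T = S from fun e => hTS e.symm)]
      by_cases hp : p S = p T ∘ Equiv.swap a b
      · have hp' : p T = p S ∘ Equiv.swap a b := by
          rw [hp]; funext i; simp
        rw [if_pos hp, if_pos hp', hp]
        simp only [Function.comp, Equiv.swap_apply_left, Equiv.swap_apply_right]
        congr 3
        ring
      · rw [if_neg hp, if_neg]
        intro hp'
        apply hp
        rw [hp']; funext i; simp

theorem YR.schur (h : YR p R) (h' : YR q Q) (U : X) (V : Y) (σ) :
    R σ * Matrix.of (fun T T' => ∑ τ, R τ T U * Q τ T' V) =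
      Matrix.of (fun T T' => ∑ τ, R τ T U * Q τ T' V) * Q σ := by
  have e : Matrix.of (fun T T' => ∑ τ, R τ T U * Q τ T' V) =
      ∑ τ, R τ * Matrix.single U V (1 : ℝ) * Q τ⁻¹ := by
    ext T T'
    rw [Matrix.sum_apply]
    apply Finset.sum_congr rfl
    intro τ _
    rw [h'.inv, Matrix.mul_apply, Finset.sum_eq_single V]
    · simp
    · intro W _ hW
      rw [Matrix.mul_single_apply_of_ne _ _ _ _ _ hW]; simp
    · simp
  rw [e, Matrix.mul_sum, Matrix.sum_mul]
  refine Fintype.sum_equiv (Equiv.mulLeft σ) _ _ ?_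
  intro τ
  simp only [Equiv.coe_mulLeft]
  rw [Matrix.mul_assoc _ _ (Q σ), ← h'.mul, h.mul, mul_inv_rev, inv_mul_cancel_right]
  simp only [Matrix.mul_assoc]

theorem YR.orth_ne (h : YR p R) (h' : YR q Q) (hne : ∀ T T', p T ≠ q T') :
    ∑ τ, (∑ T, R τ T T) * (∑ T, Q τ T T) = 0 := by
  simp_rw [Finset.sum_mul_sum]
  rw [Finset.sum_comm]
  apply Finset.sum_eq_zero
  intro T _
  rw [Finset.sum_comm]
  apply Finset.sum_eq_zero
  intro T' _
  by_contra hc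
  exact hne T T' (h.support h' _ (h.schur h' T T') T T' hc)

theorem YR.orth_self (h : YR p R) (T0 : X) :
    ∑ τ, (∑ T, R τ T T) * (∑ T, R τ T T) = (r.factorial : ℝ) := by
  have hc : (Fintype.card X : ℝ) ≠ 0 := by
    have : Nonempty X := ⟨T0⟩
    exact_mod_cast Fintype.card_ne_zero
  have h1 : ∀ T : X, (Fintype.card X : ℝ) * ∑ τ, R τ T T * R τ T T = r.factorial := by
    intro T
    have hk := fun S => h.const _ (h.schur h T T) S T
    simp only [Matrix.of_apply] at hk
    have : ∑ S, ∑ τ, R τ S T * R τ S T = (Fintype.card X : ℝ) * ∑ τ, R τ T T * R τ T T := by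
      rw [Finset.sum_congr rfl (fun S _ => hk S)]; simp
    rw [← this, Finset.sum_comm]
    have : ∀ τ, ∑ S, R τ S T * R τ S T = 1 := by
      intro τ
      have e : R τ⁻¹ * R τ = 1 := by rw [← h.mul, inv_mul_cancel, h.one]
      have e := congrFun (congrFun e T) T
      rw [h.inv, Matrix.mul_apply] at e
      simpa using e
    simp [this, Fintype.card_perm]
  have h2 : ∑ τ, (∑ T, R τ T T) * (∑ T, R τ T T) = ∑ T, ∑ τ, R τ T T * R τ T T := by
    simp_rw [Finset.sum_mul_sum]
    rw [Finset.sum_comm]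
    apply Finset.sum_congr rfl
    intro T _
    rw [Finset.sum_comm, Finset.sum_eq_single T]
    · intro T' _ hT
      by_contra hc
      exact hT (h.ext _ _ (h.support h _ (h.schur h T T') T T' hc)).symm
    · simp
  rw [h2]
  apply mul_left_cancel₀ hc
  rw [Finset.mul_sum, Finset.sum_congr rfl (fun T _ => h1 T)]
  simp

end
theorem SYT.ext' {μ : YoungDiagram} {T S : SYT μ} (h : T.pos = S.pos) : T = S := by
  cases T; cases S; cases h; rfl

instance (μ : YoungDiagram) : Finite (SYT μ) := by
  let f : SYT μ → (Fin μ.card → μ.cells) := fun T i => ⟨T.pos i, (T.range_eq _).1 ⟨i, rfl⟩⟩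
  apply Finite.of_injective f
  intro T S h
  apply SYT.ext'
  funext i
  exact congrArg Subtype.val (congrFun h i)

instance (μ : YoungDiagram) : Fintype (SYT μ) := Fintype.ofFinite _

theorem SYT.low {μ : YoungDiagram} (T : SYT μ) (i) (c : ℕ × ℕ) (hc : c ≤ T.pos i) :
    ∃ j, j ≤ i ∧ T.pos j = c := by
  rw [Prod.le_def] at hc
  have hi : ((T.pos i).1, (T.pos i).2) ∈ μ := (T.range_eq _).1 ⟨i, rfl⟩
  obtain ⟨j, hj⟩ := (T.range_eq c).2 (μ.up_left_mem hc.1 hc.2 hi)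
  obtain ⟨k, hk⟩ := (T.range_eq (c.1, (T.pos i).2)).2 (μ.up_left_mem hc.1 le_rfl hi)
  refine ⟨j, ?_, hj⟩
  have h1 : j ≤ k := by
    rcases lt_or_eq_of_le hc.2 with h | h
    · exact (T.row_lt j k (by rw [hj, hk]) (by rw [hj, hk]; exact h)).le
    · apply le_of_eq; apply T.inj; rw [hj, hk, ← h]
  have h2 : k ≤ i := by
    rcases lt_or_eq_of_le hc.1 with h | h
    · exact (T.col_lt k i (by rw [hk]) (by rw [hk]; exact h)).le
    · apply le_of_eq; apply T.inj; rw [hk, h]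
  exact h1.trans h2

theorem swap_adj_lt {n : ℕ} (a b x y : Fin n) (hab : (b : ℕ) = (a : ℕ) + 1)
    (h : Equiv.swap a b x < Equiv.swap a b y)
    (hn : ¬ (Equiv.swap a b x = a ∧ Equiv.swap a b y = b)) : x < y := by
  simp only [Equiv.swap_apply_def, Fin.lt_def, Fin.ext_iff] at *
  split_ifs at * <;> simp_all <;> omega

def SYT.swp {μ : YoungDiagram} (T : SYT μ) (a b : Fin μ.card) (hab : (b : ℕ) = (a : ℕ) + 1)
    (hn : ¬ T.pos a ≤ T.pos b) : SYT μ where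
  pos := T.pos ∘ Equiv.swap a b
  inj := T.inj.comp (Equiv.injective _)
  range_eq c := by
    rw [← T.range_eq c]
    constructor
    · rintro ⟨i, hi⟩; exact ⟨_, hi⟩
    · rintro ⟨i, hi⟩; exact ⟨Equiv.swap a b i, by simpa using hi⟩
  row_lt x y h1 h2 := by
    apply swap_adj_lt a b x y hab (T.row_lt _ _ h1 h2)
    rintro ⟨e1, e2⟩
    simp only [Function.comp, e1, e2] at h1 h2
    exact hn ⟨h1.le, h2.le⟩
  col_lt x y h1 h2 := by
    apply swap_adj_lt a b x y hab (T.col_lt _ _ h1 h2)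
    rintro ⟨e1, e2⟩
    simp only [Function.comp, e1, e2] at h1 h2
    exact hn ⟨h2.le, h1.le⟩

def qq {r : ℕ} {ν : YoungDiagram} (hν : ν.card = r) (T : SYT ν) (i : Fin r) : ℕ × ℕ :=
  T.pos (finCongr hν.symm i)

def RR (ρ : (μ : YoungDiagram) → Equiv.Perm (Fin μ.card) → SYT μ → SYT μ → ℝ) {r : ℕ}
    {ν : YoungDiagram} (hν : ν.card = r) (τ : Equiv.Perm (Fin r)) : Matrix (SYT ν) (SYT ν) ℝ :=
  Matrix.of (ρ ν ((finCongr hν.symm).permCongr τ))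

theorem yr_of (ρ : (μ : YoungDiagram) → Equiv.Perm (Fin μ.card) → SYT μ → SYT μ → ℝ)
    (hρ : ∀ μ : YoungDiagram, IsYoungOrthogonal μ (ρ μ)) {r : ℕ} {ν : YoungDiagram}
    (hν : ν.card = r) : YR (qq hν) (RR ρ hν) := by
  subst hν
  obtain ⟨h1, h2, h3⟩ := hρ ν
  have e : ∀ τ : Equiv.Perm (Fin ν.card), (finCongr rfl).permCongr τ = τ := by
    intro τ; ext i; simp
  constructor
  · ext T S
    simp only [RR, e, Matrix.of_apply, Matrix.one_apply, h1]
  · intro σ τ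
    ext T S
    simp only [RR, e, Matrix.of_apply, Matrix.mul_apply, h2, finsum_eq_sum_of_fintype]
  · exact fun T => T.inj
  · exact fun T S h => SYT.ext' h
  · exact fun T i c h => T.low i c h
  · intro a b hab T S
    simp only [RR, e, Matrix.of_apply]
    exact h3 a b hab T S
  · exact fun T a b hab hn => ⟨T.swp a b hab hn, rfl⟩
  · intro T T0 i
    exact (T0.range_eq _).2 ((T.range_eq _).1 ⟨i, rfl⟩)

theorem qq_range {r : ℕ} {ν : YoungDiagram} (hν : ν.card = r) (T : SYT ν) (c : ℕ × ℕ) :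
    (∃ i, qq hν T i = c) ↔ c ∈ ν := by
  subst hν; exact T.range_eq c

theorem qq_row {r : ℕ} {ν : YoungDiagram} (hν : ν.card = r) (T : SYT ν) : ∀ a b,
    (qq hν T a).1 = (qq hν T b).1 → (qq hν T a).2 < (qq hν T b).2 → a < b := by
  subst hν; exact T.row_lt

theorem qq_col {r : ℕ} {ν : YoungDiagram} (hν : ν.card = r) (T : SYT ν) : ∀ a b,
    (qq hν T a).2 = (qq hν T b).2 → (qq hν T a).1 < (qq hν T b).1 → a < b := by
  subst hν; exact T.col_lt

theorem qq_inj {r : ℕ} {ν : YoungDiagram} (hν : ν.card = r) (T : SYT ν) :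
    Function.Injective (qq hν T) := by
  subst hν; exact T.inj

theorem qq_ext {r : ℕ} {ν : YoungDiagram} (hν : ν.card = r) (T S : SYT ν)
    (h : qq hν T = qq hν S) : T = S := by
  subst hν; exact SYT.ext' h

theorem qq_mk {r : ℕ} {ν : YoungDiagram} (hν : ν.card = r) (f : Fin r → ℕ × ℕ)
    (inj : Function.Injective f) (hr : ∀ c : ℕ × ℕ, (∃ i, f i = c) ↔ c ∈ ν)
    (h1 : ∀ a b, (f a).1 = (f b).1 → (f a).2 < (f b).2 → a < b)
    (h2 : ∀ a b, (f a).2 = (f b).2 → (f a).1 < (f b).1 → a < b) : ∃ T : SYT ν, qq hν T = f := by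
  subst hν; exact ⟨⟨f, inj, hr, h1, h2⟩, rfl⟩

section
variable {lam : YoungDiagram} {r : ℕ} (h : r ≤ lam.card)

def shp (T : SYT lam) : YoungDiagram where
  cells := Finset.univ.image (fun i : Fin r => T.pos (Fin.castLE h i))
  isLowerSet := by
    intro c d hdc hc
    simp only [Finset.coe_image, Finset.coe_univ, Set.image_univ, Set.mem_range] at hc ⊢
    obtain ⟨i, rfl⟩ := hc
    obtain ⟨j, hj, e⟩ := T.low _ _ hdc
    rw [Fin.le_def, Fin.val_castLE] at hj
    exact ⟨⟨j, by omega⟩, by rw [← e]; rfl⟩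

theorem mem_shp (T : SYT lam) (c) : c ∈ shp h T ↔ ∃ i : Fin r, T.pos (Fin.castLE h i) = c := by
  rw [← YoungDiagram.mem_cells]; simp [shp]

theorem pos_notMem_shp (T : SYT lam) (j : Fin lam.card) (hj : r ≤ j) : T.pos j ∉ shp h T := by
  rw [mem_shp]
  rintro ⟨i, hi⟩
  have := T.inj hi
  rw [Fin.ext_iff, Fin.val_castLE] at this
  omega

theorem mem_shp' (T : SYT lam) (c) (hc : c ∈ lam) (h' : ∀ j : Fin lam.card, r ≤ j → T.pos j ≠ c) :
    c ∈ shp h T := by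
  obtain ⟨j, hj⟩ := (T.range_eq c).2 hc
  rw [mem_shp]
  by_cases hjr : (j : ℕ) < r
  · exact ⟨⟨j, hjr⟩, hj⟩
  · exact absurd hj (h' j (by omega))

theorem shp_sub (T : SYT lam) (c) (hc : c ∈ shp h T) : c ∈ lam := by
  rw [mem_shp] at hc
  obtain ⟨i, hi⟩ := hc
  exact (T.range_eq _).1 ⟨_, hi⟩

theorem shp_card (T : SYT lam) : (shp h T).card = r := by
  show (Finset.univ.image (fun i : Fin r => T.pos (Fin.castLE h i))).card = r
  rw [Finset.card_image_of_injective _ (show Function.Injective (fun i : Fin r => T.pos (Fin.castLE h i)) from T.inj.comp (Fin.castLE_injective h))]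
  simp

def gpos (U : SYT lam) (T0 : SYT (shp h U)) (i : Fin lam.card) : ℕ × ℕ :=
  if hi : (i : ℕ) < r then qq (shp_card h U) T0 ⟨i, hi⟩ else U.pos i

theorem gpos_lt (U : SYT lam) (T0 : SYT (shp h U)) (i : Fin lam.card) (hi : (i : ℕ) < r) :
    gpos h U T0 i = qq (shp_card h U) T0 ⟨i, hi⟩ := by simp [gpos, hi]

theorem gpos_ge (U : SYT lam) (T0 : SYT (shp h U)) (i : Fin lam.card) (hi : r ≤ (i : ℕ)) :
    gpos h U T0 i = U.pos i := by simp [gpos, hi]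

theorem gpos_cast (U : SYT lam) (T0 : SYT (shp h U)) (i : Fin r) :
    gpos h U T0 (Fin.castLE h i) = qq (shp_card h U) T0 i := by simp [gpos]

theorem gpos_notLe (U : SYT lam) (T0 : SYT (shp h U)) (a b : Fin lam.card) (ha : r ≤ (a : ℕ))
    (hb : (b : ℕ) < r) : ¬ gpos h U T0 a ≤ gpos h U T0 b := by
  intro hle
  rw [gpos_ge h U T0 a ha, gpos_lt h U T0 b hb] at hle
  apply pos_notMem_shp h U a ha
  exact (shp h U).up_left_mem hle.1 hle.2 ((qq_range (shp_card h U) T0 _).1 ⟨_, rfl⟩)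

def glue (U : SYT lam) (T0 : SYT (shp h U)) : SYT lam where
  pos := gpos h U T0
  inj := by
    intro a b e
    by_cases ha : (a : ℕ) < r <;> by_cases hb : (b : ℕ) < r
    · rw [gpos_lt h U T0 a ha, gpos_lt h U T0 b hb] at e
      have := qq_inj _ _ e
      simpa [Fin.ext_iff] using this
    · exact absurd e.ge (gpos_notLe h U T0 b a (by omega) ha)
    · exact absurd e.le (gpos_notLe h U T0 a b (by omega) hb)
    · rw [gpos_ge h U T0 a (by omega), gpos_ge h U T0 b (by omega)] at e
      exact U.inj e
  range_eq c := by
    constructor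
    · rintro ⟨i, rfl⟩
      by_cases hi : (i : ℕ) < r
      · rw [gpos_lt h U T0 i hi]
        exact shp_sub h U _ ((qq_range (shp_card h U) T0 _).1 ⟨_, rfl⟩)
      · rw [gpos_ge h U T0 i (by omega)]
        exact (U.range_eq _).1 ⟨_, rfl⟩
    · intro hc
      by_cases hs : c ∈ shp h U
      · obtain ⟨i, hi⟩ := (qq_range (shp_card h U) T0 _).2 hs
        exact ⟨Fin.castLE h i, by rw [gpos_cast, hi]⟩
      · obtain ⟨j, hj⟩ := (U.range_eq c).2 hc
        refine ⟨j, ?_⟩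
        rw [gpos_ge, hj]
        by_contra hlt
        apply hs
        rw [mem_shp]
        exact ⟨⟨j, by omega⟩, hj⟩
  row_lt a b h1 h2 := by
    by_cases ha : (a : ℕ) < r <;> by_cases hb : (b : ℕ) < r
    · rw [gpos_lt h U T0 a ha, gpos_lt h U T0 b hb] at h1 h2
      have := qq_row _ _ _ _ h1 h2
      exact Fin.lt_def.2 (Fin.lt_def.1 this)
    · rw [Fin.lt_def]; omega
    · exact absurd ⟨h1.le, h2.le⟩ (gpos_notLe h U T0 a b (by omega) hb)
    · rw [gpos_ge h U T0 a (by omega), gpos_ge h U T0 b (by omega)] at h1 h2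
      exact U.row_lt _ _ h1 h2
  col_lt a b h1 h2 := by
    by_cases ha : (a : ℕ) < r <;> by_cases hb : (b : ℕ) < r
    · rw [gpos_lt h U T0 a ha, gpos_lt h U T0 b hb] at h1 h2
      have := qq_col _ _ _ _ h1 h2
      exact Fin.lt_def.2 (Fin.lt_def.1 this)
    · rw [Fin.lt_def]; omega
    · exact absurd ⟨h2.le, h1.le⟩ (gpos_notLe h U T0 a b (by omega) hb)
    · rw [gpos_ge h U T0 a (by omega), gpos_ge h U T0 b (by omega)] at h1 h2
      exact U.col_lt _ _ h1 h2

theorem glue_inj (U : SYT lam) : Function.Injective (glue h U) := by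
  intro T S e
  apply qq_ext (shp_card h U)
  funext i
  have : gpos h U T = gpos h U S := congrArg SYT.pos e
  rw [← gpos_cast, ← gpos_cast, this]

theorem glue_surj (U S : SYT lam) (hS : ∀ i : Fin lam.card, r ≤ (i : ℕ) → S.pos i = U.pos i) :
    ∃ S0, glue h U S0 = S := by
  obtain ⟨S0, e⟩ := qq_mk (shp_card h U) (fun i => S.pos (Fin.castLE h i))
    (S.inj.comp (Fin.castLE_injective h))
    (by
      intro c
      rw [← mem_shp h S]
      constructor
      · intro hc
        apply mem_shp' h U c (shp_sub h S c hc)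
        rintro j hj rfl
        rw [← hS j hj] at hc
        exact pos_notMem_shp h S j hj hc
      · intro hc
        apply mem_shp' h S c (shp_sub h U c hc)
        rintro j hj rfl
        rw [hS j hj] at hc
        exact pos_notMem_shp h U j hj hc)
    (fun a b h1 h2 => Fin.lt_def.2 (Fin.lt_def.1 (S.row_lt _ _ h1 h2)))
    (fun a b h1 h2 => Fin.lt_def.2 (Fin.lt_def.1 (S.col_lt _ _ h1 h2)))
  refine ⟨S0, SYT.ext' ?_⟩
  funext i
  show gpos h U S0 i = _
  by_cases hi : (i : ℕ) < r
  · rw [gpos_lt h U S0 i hi, e]; rfl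
  · rw [gpos_ge h U S0 i (by omega), hS i (by omega)]

def rel : Setoid (SYT lam) where
  r T S := ∀ i : Fin lam.card, r ≤ (i : ℕ) → T.pos i = S.pos i
  iseqv := ⟨fun _ _ _ => rfl, fun h i hi => (h i hi).symm,
    fun h h' i hi => (h i hi).trans (h' i hi)⟩

theorem sum_glue (f : SYT lam → ℝ) :
    ∑ T, f T = ∑ c : Quotient (rel (lam := lam) (r := r)),
      ∑ T0 : SYT (shp h c.out), f (glue h c.out T0) := by
  rw [← Fintype.sum_sigma' (fun (c : Quotient (rel (lam := lam) (r := r)))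
    (T0 : SYT (shp h c.out)) => f (glue h c.out T0))]
  symm
  have hg : ∀ U T0, (rel (lam := lam) (r := r)) (glue h U T0) U := fun U T0 i hi =>
    gpos_ge h U T0 i hi
  apply Fintype.sum_bijective
    (fun x : (Σ c : Quotient (rel (lam := lam) (r := r)), SYT (shp h c.out)) =>
      glue h x.1.out x.2)
  · constructor
    · rintro ⟨c, T0⟩ ⟨c', T0'⟩ e
      simp only at e
      have hcc : c = c' := by
        rw [← Quotient.out_eq c, ← Quotient.out_eq c',
          ← Quotient.sound (hg c.out T0), ← Quotient.sound (hg c'.out T0'), e]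
      subst hcc
      rw [glue_inj h _ e]
    · intro T
      obtain ⟨S0, e⟩ := glue_surj h (Quotient.mk (rel (lam := lam) (r := r)) T).out T
        (fun i hi => ((Quotient.mk_out (s := rel (lam := lam) (r := r)) T) i hi).symm)
      exact ⟨⟨_, S0⟩, e⟩
  · intro x; rfl

theorem via_swap (a b : Fin r) : (Equiv.swap a b).viaEmbedding (Fin.castLEEmb h) =
    Equiv.swap (Fin.castLE h a) (Fin.castLE h b) := by
  ext1 i
  by_cases hi : i ∈ Set.range (Fin.castLEEmb h)
  · obtain ⟨j, rfl⟩ := hi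
    rw [Equiv.Perm.viaEmbedding_apply]
    exact ((Fin.castLE_injective h).swap_apply a b j).symm
  · rw [Equiv.Perm.viaEmbedding_apply_of_notMem _ _ _ hi, Equiv.swap_apply_of_ne_of_ne]
    · rintro rfl; exact hi ⟨a, rfl⟩
    · rintro rfl; exact hi ⟨b, rfl⟩

def GG (U : SYT lam) : Matrix (SYT (shp h U)) (SYT lam) ℝ :=
  Matrix.of fun T0 S => if S = glue h U T0 then 1 else 0

theorem GG_mul (U : SYT lam) (A : Matrix (SYT lam) (SYT lam) ℝ) (T0 S) :
    (GG h U * A) T0 S = A (glue h U T0) S := by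
  simp [Matrix.mul_apply, GG]

theorem mul_GG (U : SYT lam) (A : Matrix (SYT (shp h U)) (SYT (shp h U)) ℝ) (T0 S0) :
    (A * GG h U) T0 (glue h U S0) = A T0 S0 := by
  simp [Matrix.mul_apply, GG, (glue_inj h U).eq_iff]

theorem swap_glue (U : SYT lam) (T0 S0) (a b : Fin r) :
    qq rfl (glue h U S0) = qq rfl (glue h U T0) ∘ Equiv.swap (Fin.castLE h a) (Fin.castLE h b) ↔
    qq (shp_card h U) S0 = qq (shp_card h U) T0 ∘ Equiv.swap a b := by
  change gpos h U S0 = gpos h U T0 ∘ Equiv.swap (Fin.castLE h a) (Fin.castLE h b) ↔ _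
  constructor
  · intro e
    funext i
    have := congrFun e (Fin.castLE h i)
    rw [gpos_cast, Function.comp, (Fin.castLE_injective h).swap_apply, gpos_cast] at this
    exact this
  · intro e
    funext i
    by_cases hi : (i : ℕ) < r
    · obtain ⟨j, rfl⟩ : ∃ j : Fin r, i = Fin.castLE h j := ⟨⟨i, hi⟩, rfl⟩
      rw [gpos_cast, Function.comp, (Fin.castLE_injective h).swap_apply, gpos_cast, e]
      rfl
    · rw [Function.comp, Equiv.swap_apply_of_ne_of_ne, gpos_ge h U S0 i (by omega),
        gpos_ge h U T0 i (by omega)]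
      · rintro rfl; simp at hi
      · rintro rfl; simp at hi

theorem inter (ρ : (μ : YoungDiagram) → Equiv.Perm (Fin μ.card) → SYT μ → SYT μ → ℝ)
    (hρ : ∀ μ : YoungDiagram, IsYoungOrthogonal μ (ρ μ)) (U : SYT lam)
    (σ : Equiv.Perm (Fin r)) :
    GG h U * RR ρ rfl (σ.viaEmbedding (Fin.castLEEmb h)) = RR ρ (shp_card h U) σ * GG h U := by
  have h1 := yr_of ρ hρ (rfl : lam.card = lam.card)
  have h2 := yr_of ρ hρ (shp_card h U)
  induction σ using perm_adj_ind with
  | h1 =>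
    have : (1 : Equiv.Perm (Fin r)).viaEmbedding (Fin.castLEEmb h) = 1 :=
      map_one (Equiv.Perm.viaEmbeddingHom (Fin.castLEEmb h))
    rw [this, h1.one, h2.one]; simp
  | hm σ τ e1 e2 =>
    have : (σ * τ).viaEmbedding (Fin.castLEEmb h) = σ.viaEmbedding (Fin.castLEEmb h) *
        τ.viaEmbedding (Fin.castLEEmb h) :=
      map_mul (Equiv.Perm.viaEmbeddingHom (Fin.castLEEmb h)) σ τ
    rw [this, h1.mul, h2.mul, ← Matrix.mul_assoc, e1, Matrix.mul_assoc, e2, Matrix.mul_assoc]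
  | hs a b hab =>
    have hab' : ((Fin.castLE h b : Fin lam.card) : ℕ) = (Fin.castLE h a : Fin lam.card) + 1 := by
      simpa using hab
    rw [via_swap]
    ext T0 S
    rw [GG_mul, h1.swap _ _ hab']
    by_cases hS : ∃ S0, glue h U S0 = S
    · obtain ⟨S0, rfl⟩ := hS
      rw [mul_GG, h2.swap a b hab]
      have ea : ∀ i, qq rfl (glue h U T0) (Fin.castLE h i) = qq (shp_card h U) T0 i :=
        gpos_cast h U T0
      simp only [(glue_inj h U).eq_iff, swap_glue, ea]
    · rw [if_neg (by rintro rfl; exact hS ⟨_, rfl⟩), if_neg]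
      · symm
        rw [Matrix.mul_apply]
        apply Finset.sum_eq_zero
        intro S0 _
        have : GG h U S0 S = 0 := by
          simp only [GG, Matrix.of_apply]
          exact if_neg (fun e => hS ⟨S0, e.symm⟩)
        rw [this, mul_zero]
      · intro e
        apply hS
        apply glue_surj
        intro i hi
        have e' := congrFun e i
        rw [Function.comp, Equiv.swap_apply_of_ne_of_ne] at e'
        · exact e'.trans (gpos_ge h U T0 i hi)
        · rintro rfl; rw [Fin.val_castLE] at hi; omega
        · rintro rfl; rw [Fin.val_castLE] at hi; omega

theorem block_sum (ρ : (μ : YoungDiagram) → Equiv.Perm (Fin μ.card) → SYT μ → SYT μ → ℝ)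
    (hρ : ∀ μ : YoungDiagram, IsYoungOrthogonal μ (ρ μ)) (σ : Equiv.Perm (Fin r)) :
    ∑ T : SYT lam, ∑ S : SYT lam, RR ρ rfl (σ.viaEmbedding (Fin.castLEEmb h)) T S =
    ∑ c : Quotient (rel (lam := lam) (r := r)), ∑ T : SYT (shp h c.out), ∑ S : SYT (shp h c.out),
      RR ρ (shp_card h c.out) σ T S := by
  rw [sum_glue h]
  refine Finset.sum_congr rfl fun c _ => Finset.sum_congr rfl fun T0 _ => ?_
  rw [Finset.sum_congr rfl fun S _ => (GG_mul h c.out _ T0 S).symm, inter h ρ hρ]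
  simp_rw [Matrix.mul_apply]
  rw [Finset.sum_comm]
  refine Finset.sum_congr rfl fun S0 _ => ?_
  rw [← Finset.mul_sum]
  simp [GG]

theorem block_tr (ρ : (μ : YoungDiagram) → Equiv.Perm (Fin μ.card) → SYT μ → SYT μ → ℝ)
    (hρ : ∀ μ : YoungDiagram, IsYoungOrthogonal μ (ρ μ)) (σ : Equiv.Perm (Fin r)) :
    ∑ T : SYT lam, RR ρ rfl (σ.viaEmbedding (Fin.castLEEmb h)) T T =
    ∑ c : Quotient (rel (lam := lam) (r := r)), ∑ T : SYT (shp h c.out),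
      RR ρ (shp_card h c.out) σ T T := by
  rw [sum_glue h]
  refine Finset.sum_congr rfl fun c _ => Finset.sum_congr rfl fun T0 _ => ?_
  rw [← GG_mul h c.out (RR ρ rfl _) T0, inter h ρ hρ, mul_GG]

theorem shp_nonempty (U : SYT lam) : Nonempty (SYT (shp h U)) :=
  ⟨(glue_surj h U U (fun _ _ => rfl)).choose⟩

end

theorem yd_bound (ν : YoungDiagram) (c : ℕ × ℕ) (hc : c ∈ ν) : c.1 < ν.card ∧ c.2 < ν.card := by
  constructor
  · have : (Finset.range (c.1 + 1)).image (fun i => (i, c.2)) ⊆ ν.cells := by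
      intro d hd
      simp only [Finset.mem_image, Finset.mem_range] at hd
      obtain ⟨i, hi, rfl⟩ := hd
      rw [YoungDiagram.mem_cells]
      exact ν.up_left_mem (show i ≤ c.1 by omega) le_rfl hc
    have := Finset.card_le_card this
    rw [Finset.card_image_of_injective _ (fun a b e => (Prod.ext_iff.1 e).1),
      Finset.card_range] at this
    exact this
  · have : (Finset.range (c.2 + 1)).image (fun i => (c.1, i)) ⊆ ν.cells := by
      intro d hd
      simp only [Finset.mem_image, Finset.mem_range] at hd
      obtain ⟨i, hi, rfl⟩ := hd
      rw [YoungDiagram.mem_cells]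
      exact ν.up_left_mem le_rfl (show i ≤ c.2 by omega) hc
    have := Finset.card_le_card this
    rw [Finset.card_image_of_injective _ (fun a b e => (Prod.ext_iff.1 e).2),
      Finset.card_range] at this
    exact this

instance (r : ℕ) : Finite {ν : YoungDiagram // ν.card = r} := by
  let f : {ν : YoungDiagram // ν.card = r} →
      ((Finset.range r ×ˢ Finset.range r).powerset : Finset (Finset (ℕ × ℕ))) :=
    fun ν => ⟨ν.1.cells, by
      rw [Finset.mem_powerset]
      intro c hc
      have := yd_bound ν.1 c hc
      rw [ν.2] at this
      simpa using this⟩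
  apply Finite.of_injective f
  intro a b e
  have := congrArg Subtype.val e
  exact Subtype.ext (YoungDiagram.ext this)

instance (r : ℕ) : Fintype {ν : YoungDiagram // ν.card = r} := Fintype.ofFinite _

theorem orth (ρ : (μ : YoungDiagram) → Equiv.Perm (Fin μ.card) → SYT μ → SYT μ → ℝ)
    (hρ : ∀ μ : YoungDiagram, IsYoungOrthogonal μ (ρ μ)) {r : ℕ}
    (ν κ : {ν : YoungDiagram // ν.card = r}) (hne : Nonempty (SYT κ.1)) :
    ∑ τ : Equiv.Perm (Fin r), (∑ T, RR ρ ν.2 τ T T) * (∑ T, RR ρ κ.2 τ T T) =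
      if ν = κ then (r.factorial : ℝ) else 0 := by
  split_ifs with h
  · subst h
    exact (yr_of ρ hρ ν.2).orth_self hne.some
  · apply (yr_of ρ hρ ν.2).orth_ne (yr_of ρ hρ κ.2)
    intro T T' e
    apply h
    apply Subtype.ext
    apply SetLike.ext
    intro c
    rw [← qq_range ν.2 T, ← qq_range κ.2 T', e]

theorem ts_eq (ρ : (μ : YoungDiagram) → Equiv.Perm (Fin μ.card) → SYT μ → SYT μ → ℝ)
    {r : ℕ} {ν : YoungDiagram} (hν : ν.card = r) (τ : Equiv.Perm (Fin r)) :
    totalSum ν (ρ ν) ((finCongr hν.symm).permCongr τ) =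
      (∑ T, ∑ S, RR ρ hν τ T S) / (Fintype.card (SYT ν)) := by
  simp only [totalSum, finsum_eq_sum_of_fintype, Nat.card_eq_fintype_card, RR, Matrix.of_apply]

theorem nt_eq (ρ : (μ : YoungDiagram) → Equiv.Perm (Fin μ.card) → SYT μ → SYT μ → ℝ)
    {r : ℕ} {ν : YoungDiagram} (hν : ν.card = r) (τ : Equiv.Perm (Fin r)) :
    normTrace ν (ρ ν) ((finCongr hν.symm).permCongr τ) =
      (∑ T, RR ρ hν τ T T) / (Fintype.card (SYT ν)) := by
  simp only [normTrace, finsum_eq_sum_of_fintype, Nat.card_eq_fintype_card, RR, Matrix.of_apply]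

/-- For `λ ⊢ n`, `σ ∈ S_r` with `r ≤ n`, and the total sum
`TS^λ(σ) = (1/dim λ)·Σ_{T,T'} π^λ(σ)_{T,T'}` of the entries of Young's orthogonal
representation matrix, one has
`TS^λ(σ) = Σ_{τ∈S_r} E_Pl^r[χ̂^ν(τ)·TS^ν(σ)]·χ̂^λ(τ)`,
where `E_Pl^r` is the expectation over `ν ⊢ r` under the Plancherel measure `(dim ν)²/r!`
and `χ̂` is the normalized character. -/
theorem stmt10 (ρ : (μ : YoungDiagram) → Equiv.Perm (Fin μ.card) → SYT μ → SYT μ → ℝ)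
    (hρ : ∀ μ : YoungDiagram, IsYoungOrthogonal μ (ρ μ))
    (lam : YoungDiagram) (n r : ℕ) (hn : lam.card = n) (hrn : r ≤ n)
    (σ : Equiv.Perm (Fin r)) :
    totalSum lam (ρ lam) (σ.viaEmbedding (Fin.castLEEmb (show r ≤ lam.card by omega))) =
      ∑ τ : Equiv.Perm (Fin r),
        (∑ᶠ ν : {ν : YoungDiagram // ν.card = r},
          ((Nat.card (SYT ν.1) : ℝ) ^ 2 / (r.factorial : ℝ)) *
            (normTrace ν.1 (ρ ν.1) ((finCongr ν.2.symm).permCongr τ) *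
              totalSum ν.1 (ρ ν.1) ((finCongr ν.2.symm).permCongr σ))) *
          normTrace lam (ρ lam)
            (τ.viaEmbedding (Fin.castLEEmb (show r ≤ lam.card by omega))) := by
  have h : r ≤ lam.card := by omega
  have e : ∀ τ : Equiv.Perm (Fin lam.card), (finCongr (rfl : lam.card = lam.card)).permCongr τ
      = τ := by
    intro τ; ext i; simp
  have hL := fun τ => ts_eq ρ (rfl : lam.card = lam.card) τ
  have hN := fun τ => nt_eq ρ (rfl : lam.card = lam.card) τ
  simp only [e] at hL hN
  have hterm : ∀ (τ : Equiv.Perm (Fin r)) (ν : {ν : YoungDiagram // ν.card = r}),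
      ((Nat.card (SYT ν.1) : ℝ) ^ 2 / (r.factorial : ℝ)) *
        (normTrace ν.1 (ρ ν.1) ((finCongr ν.2.symm).permCongr τ) *
          totalSum ν.1 (ρ ν.1) ((finCongr ν.2.symm).permCongr σ)) =
      (∑ T, RR ρ ν.2 τ T T) * (∑ T, ∑ S, RR ρ ν.2 σ T S) / r.factorial := by
    intro τ ν
    rw [ts_eq ρ ν.2, nt_eq ρ ν.2, Nat.card_eq_fintype_card]
    by_cases hc : (Fintype.card (SYT ν.1) : ℝ) = 0
    · have : IsEmpty (SYT ν.1) := Fintype.card_eq_zero_iff.1 (by exact_mod_cast hc)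
      simp
    · field_simp
  simp only [hL, hN, hterm, finsum_eq_sum_of_fintype]
  rw [block_sum h ρ hρ]
  simp only [block_tr h ρ hρ]
  have hf : (r.factorial : ℝ) ≠ 0 := by exact_mod_cast r.factorial_ne_zero
  simp_rw [mul_div_assoc']
  rw [← Finset.sum_div]
  congr 1
  have : ∀ (ν : {ν : YoungDiagram // ν.card = r}) (c : Quotient (rel (lam := lam) (r := r))),
      ∑ τ : Equiv.Perm (Fin r),
        (∑ T, RR ρ ν.2 τ T T) * (∑ T, ∑ S, RR ρ ν.2 σ T S) / r.factorial *
          (∑ T, RR ρ (shp_card h c.out) τ T T) =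
      if ν = ⟨_, shp_card h c.out⟩ then (∑ T, ∑ S, RR ρ ν.2 σ T S) else 0 := by
    intro ν c
    have ho := orth ρ hρ ν ⟨_, shp_card h c.out⟩ (shp_nonempty h c.out)
    have : ∀ τ : Equiv.Perm (Fin r),
        (∑ T, RR ρ ν.2 τ T T) * (∑ T, ∑ S, RR ρ ν.2 σ T S) / r.factorial *
          (∑ T, RR ρ (shp_card h c.out) τ T T) =
        ((∑ T, RR ρ ν.2 τ T T) * (∑ T, RR ρ (shp_card h c.out) τ T T)) *
          ((∑ T, ∑ S, RR ρ ν.2 σ T S) / r.factorial) := fun τ => by ring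
    simp_rw [this]
    rw [← Finset.sum_mul, ho]
    split_ifs
    · field_simp
    · simp
  have h2 : ∀ ν : {ν : YoungDiagram // ν.card = r}, 
      ∑ τ : Equiv.Perm (Fin r), ∑ c : Quotient (rel (lam := lam) (r := r)),
        (∑ T, RR ρ ν.2 τ T T) * (∑ T, ∑ S, RR ρ ν.2 σ T S) / r.factorial *
          (∑ T, RR ρ (shp_card h c.out) τ T T) =
      ∑ c : Quotient (rel (lam := lam) (r := r)),
      if ν = ⟨_, shp_card h c.out⟩ then (∑ T, ∑ S, RR ρ ν.2 σ T S) else 0 := by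
    intro ν
    rw [Finset.sum_comm]
    exact Finset.sum_congr rfl fun c _ => this ν c
  symm
  trans ∑ τ : Equiv.Perm (Fin r), ∑ ν : {ν : YoungDiagram // ν.card = r},
      ∑ c : Quotient (rel (lam := lam) (r := r)),
        (∑ T, RR ρ ν.2 τ T T) * (∑ T, ∑ S, RR ρ ν.2 σ T S) / r.factorial *
          (∑ T, RR ρ (shp_card h c.out) τ T T)
  · exact Finset.sum_congr rfl fun τ _ => Finset.sum_mul_sum _ _ _ _
  rw [Finset.sum_comm, Finset.sum_congr rfl fun ν _ => h2 ν, Finset.sum_comm]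
  refine Finset.sum_congr rfl fun c _ => ?_
  rw [Finset.sum_ite_eq']
  simp

end
end

section
/- Let λ = (λ_1,...,λ_l) be a strict partition and k an odd positive integer. Define ψ_k(z;λ) = (2z−k)·(z−1)^{↓(k−1)}·Π_{i=1}^l [(z−λ_i−k)(z+λ_i)] / [(z−λ_i)(z+λ_i−k)], treating λ_i as formal (generic) parameters. Then the sum of residues of ψ_k at its 2l simple poles λ_1,...,λ_l, k−λ_1,...,k−λ_l equals −4k · Σ_{i=1}^l λ_i^{↓k} · Π_{j≠i} [(λ_i−λ_j−k)(λ_i+λ_j)] / [(λ_i−λ_j)(λ_i+λ_j−k)], where x^{↓k} = x(x−1)···(x−k+1) is the falling factorial. -/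
open Filter

noncomputable section

/-- `ψ_k(z; λ) = (2z−k)·(z−1)^{↓(k−1)}·Π_{i=1}^l [(z−λ_i−k)(z+λ_i)]/[(z−λ_i)(z+λ_i−k)]`. -/
def psiK (k l : ℕ) (lam : Fin l → ℂ) (z : ℂ) : ℂ :=
  (2 * z - (k : ℂ)) * (∏ a ∈ Finset.range (k - 1), (z - 1 - (a : ℂ))) *
    ∏ i : Fin l, ((z - lam i - k) * (z + lam i)) / ((z - lam i) * (z + lam i - k))

theorem psiK_symm (k l : ℕ) (hk : Odd k) (lam : Fin l → ℂ) (z : ℂ) :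
    psiK k l lam ((k : ℂ) - z) = - psiK k l lam z := by
  obtain ⟨m, rfl⟩ := hk
  unfold psiK
  have h1 : (∏ a ∈ Finset.range (2 * m + 1 - 1), (((2 * m + 1 : ℕ) : ℂ) - z - 1 - (a : ℂ)))
      = ∏ a ∈ Finset.range (2 * m + 1 - 1), (z - 1 - (a : ℂ)) := by
    rw [Nat.add_sub_cancel]
    rw [← Finset.prod_range_reflect]
    have : ∀ a ∈ Finset.range (2 * m),
        (((2 * m + 1 : ℕ) : ℂ) - z - 1 - ((2 * m - 1 - a : ℕ) : ℂ)) = (-1) * (z - 1 - (a : ℂ)) := by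
      intro a ha
      have ha' := Finset.mem_range.mp ha
      have e : ((2 * m - 1 - a : ℕ) : ℂ) + 1 + a = 2 * m := by
        have : (2 * m - 1 - a) + 1 + a = 2 * m := by omega
        exact_mod_cast congrArg (Nat.cast : ℕ → ℂ) this
      push_cast
      linear_combination -e
    rw [Finset.prod_congr rfl this, Finset.prod_mul_distrib]
    simp
  have h2 : ∀ i : Fin l,
      ((((2 * m + 1 : ℕ) : ℂ) - z - lam i - (2 * m + 1 : ℕ)) * (((2 * m + 1 : ℕ) : ℂ) - z + lam i)) /
        ((((2 * m + 1 : ℕ) : ℂ) - z - lam i) * (((2 * m + 1 : ℕ) : ℂ) - z + lam i - (2 * m + 1 : ℕ)))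
      = ((z - lam i - (2 * m + 1 : ℕ)) * (z + lam i)) /
        ((z - lam i) * (z + lam i - (2 * m + 1 : ℕ))) := by
    intro i
    congr 1 <;> ring
  rw [h1, Finset.prod_congr rfl (fun i _ => h2 i)]
  ring

theorem psiK_res (k l : ℕ) (hk : Odd k) (lam : Fin l → ℂ)
    (hinj : Function.Injective lam)
    (hgen : ∀ i j : Fin l, lam i + lam j ≠ (k : ℂ)) (i : Fin l) :
    Tendsto (fun z : ℂ => (z - lam i) * psiK k l lam z)
      (nhdsWithin (lam i) {lam i}ᶜ) (nhds (-2 * (k : ℂ) *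
        ((∏ a ∈ Finset.range k, (lam i - (a : ℂ))) *
          ∏ j ∈ Finset.univ.erase i,
            ((lam i - lam j - k) * (lam i + lam j)) /
              ((lam i - lam j) * (lam i + lam j - k))))) := by
  have hne : ∀ j, lam i + lam j - k ≠ 0 := fun j => sub_ne_zero.mpr (hgen i j)
  let g : ℂ → ℂ := fun z =>
    (2 * z - (k : ℂ)) * (∏ a ∈ Finset.range (k - 1), (z - 1 - (a : ℂ))) *
      (((z - lam i - k) * (z + lam i)) / (z + lam i - k) *
      ∏ j ∈ Finset.univ.erase i,
        ((z - lam j - k) * (z + lam j)) / ((z - lam j) * (z + lam j - k)))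
  have hc : ContinuousAt g (lam i) := by
    have hp : ContinuousAt (fun z : ℂ => ∏ j ∈ Finset.univ.erase i,
        ((z - lam j - k) * (z + lam j)) / ((z - lam j) * (z + lam j - k))) (lam i) := by
      refine tendsto_finsetProd _ fun j hj => ?_
      have hji : j ≠ i := (Finset.mem_erase.mp hj).1
      have h0 : (lam i - lam j) * (lam i + lam j - k) ≠ 0 :=
        mul_ne_zero (sub_ne_zero.mpr fun h => hji (hinj h).symm) (hne j)
      have hn : ContinuousAt (fun z : ℂ => (z - lam j - k) * (z + lam j)) (lam i) := by fun_prop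
      have hd : ContinuousAt (fun z : ℂ => (z - lam j) * (z + lam j - k)) (lam i) := by fun_prop
      exact hn.div hd h0
    have hn : ContinuousAt (fun z : ℂ => (z - lam i - k) * (z + lam i)) (lam i) := by fun_prop
    have hd : ContinuousAt (fun z : ℂ => (z + lam i - k)) (lam i) := by fun_prop
    have ha : ContinuousAt (fun z : ℂ => (2 * z - (k : ℂ)) *
      (∏ a ∈ Finset.range (k - 1), (z - 1 - (a : ℂ)))) (lam i) := by fun_prop
    exact ha.mul ((hn.div hd (hne i)).mul hp)
  have hg : g (lam i) = -2 * (k : ℂ) *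
        ((∏ a ∈ Finset.range k, (lam i - (a : ℂ))) *
          ∏ j ∈ Finset.univ.erase i,
            ((lam i - lam j - k) * (lam i + lam j)) /
              ((lam i - lam j) * (lam i + lam j - k))) := by
    obtain ⟨m, hm⟩ := hk
    have hf : ∏ a ∈ Finset.range k, (lam i - (a : ℂ)) =
        (∏ a ∈ Finset.range (k - 1), (lam i - 1 - (a : ℂ))) * lam i := by
      have : k = (k - 1) + 1 := by omega
      conv_lhs => rw [this]
      rw [Finset.prod_range_succ']
      congr 1
      · exact Finset.prod_congr rfl fun a _ => by push_cast; ring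
      · simp
    have hq : (2 * lam i - k) * (((lam i - lam i - k) * (lam i + lam i)) / (lam i + lam i - k))
        = -2 * k * lam i := by
      have := hne i
      rw [show 2 * lam i - (k : ℂ) = lam i + lam i - k by ring, mul_div_cancel₀ _ this]
      ring
    simp only [g]
    rw [hf]
    generalize (∏ j ∈ Finset.univ.erase i, _ : ℂ) = P
    linear_combination (∏ a ∈ Finset.range (k - 1), (lam i - 1 - (a : ℂ))) * P * hq
  rw [← hg]
  refine (hc.tendsto.mono_left nhdsWithin_le_nhds).congr' ?_
  filter_upwards [self_mem_nhdsWithin] with z hz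
  have hz' : z - lam i ≠ 0 := sub_ne_zero.mpr hz
  simp only [g, psiK]
  rw [← Finset.mul_prod_erase Finset.univ _ (Finset.mem_univ i)]
  have : ((z - lam i - k) * (z + lam i)) / (z + lam i - k) =
      (z - lam i) * (((z - lam i - k) * (z + lam i)) / ((z - lam i) * (z + lam i - k))) := by
    rw [← mul_div_assoc, mul_div_mul_left _ _ hz']
  rw [this]
  ring

/-- Let `λ = (λ_1, ..., λ_l)` be (the parts of) a strict partition, treated as generic
parameters (all the poles `λ_1, ..., λ_l, k−λ_1, ..., k−λ_l` of `ψ_k` are simple and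
distinct), and `k` an odd positive integer.  Then the sum of the residues of `ψ_k` at its
`2l` simple poles (each residue `r_i` at `λ_i`, resp. `s_i` at `k−λ_i`, being the limit of
`(z−a)·ψ_k(z)` as `z → a`) equals
`−4k · Σ_i λ_i^{↓k} · Π_{j≠i} [(λ_i−λ_j−k)(λ_i+λ_j)]/[(λ_i−λ_j)(λ_i+λ_j−k)]`. -/
theorem stmt15 (k l : ℕ) (hk : Odd k) (lam : Fin l → ℂ)
    (hinj : Function.Injective lam)
    (hgen : ∀ i j : Fin l, lam i + lam j ≠ (k : ℂ))
    (r s : Fin l → ℂ)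
    (hr : ∀ i : Fin l, Tendsto (fun z : ℂ => (z - lam i) * psiK k l lam z)
      (nhdsWithin (lam i) {lam i}ᶜ) (nhds (r i)))
    (hs : ∀ i : Fin l, Tendsto (fun z : ℂ => (z - ((k : ℂ) - lam i)) * psiK k l lam z)
      (nhdsWithin ((k : ℂ) - lam i) {(k : ℂ) - lam i}ᶜ) (nhds (s i))) :
    ∑ i : Fin l, (r i + s i) =
      -4 * (k : ℂ) * ∑ i : Fin l,
        (∏ a ∈ Finset.range k, (lam i - (a : ℂ))) *
          ∏ j ∈ Finset.univ.erase i,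
            ((lam i - lam j - k) * (lam i + lam j)) /
              ((lam i - lam j) * (lam i + lam j - k)) := by
  have h1 : ∀ i, r i = _ := fun i =>
    tendsto_nhds_unique (hr i) (psiK_res k l hk lam hinj hgen i)
  have h2 : ∀ i, s i = r i := fun i => by
    have ht : Tendsto (fun w : ℂ => (k : ℂ) - w) (nhdsWithin (lam i) {lam i}ᶜ)
        (nhdsWithin ((k : ℂ) - lam i) {(k : ℂ) - lam i}ᶜ) := by
      refine tendsto_nhdsWithin_iff.mpr ⟨?_, ?_⟩
      · have : ContinuousAt (fun w : ℂ => (k : ℂ) - w) (lam i) := by fun_prop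
        exact this.tendsto.mono_left nhdsWithin_le_nhds
      · filter_upwards [self_mem_nhdsWithin] with w hw h
        exact hw (sub_right_injective h)
    refine tendsto_nhds_unique ((hs i).comp ht) ((hr i).congr fun w => ?_)
    simp only [Function.comp, psiK_symm k l hk]
    ring
  rw [Finset.mul_sum]
  refine Finset.sum_congr rfl fun i _ => ?_
  rw [h2, h1]
  ring

end
end
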